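/- Let (Ω, 𝔽, P) be a probability space, let Y and I be independent nonnegative real-valued random variables on Ω, and let σ² > 0. If ω ↦ ln(1 + Y(ω)/(I(ω) + σ²)) is integrable, then E[ln(1 + Y/(I + σ²))] = ∫_0^∞ (1/z) · (1 − E[e^{−zY}]) · E[e^{−zI}] · e^{−zσ²} dz, where the right-hand side is a Lebesgue integral over z ∈ (0, ∞). -/

import Mathlib

open MeasureTheory Real Set

/-- A set whose outer measure and that of its complement add up to one is null measurable. -/
theorem nullMeas_of_add_compl {Ω : Type*} [MeasurableSpace Ω]
    (P : Measure Ω) [IsProbabilityMeasure P] (s : Set Ω) (h : P s + P sᶜ = 1) :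
    NullMeasurableSet s P := by
  have h1 := measure_union_add_inter (μ := P) (toMeasurable P s)
    (measurableSet_toMeasurable P sᶜ)
  have hu : toMeasurable P s ∪ toMeasurable P sᶜ = univ := by
    apply eq_univ_of_univ_subset
    rw [← union_compl_self s]
    exact union_subset_union (subset_toMeasurable P s) (subset_toMeasurable P sᶜ)
  rw [hu, measure_toMeasurable, measure_toMeasurable, h, measure_univ] at h1
  have h0 : P (toMeasurable P s ∩ toMeasurable P sᶜ) = 0 := by
    have : (1 : ENNReal) + P (toMeasurable P s ∩ toMeasurable P sᶜ) = 1 + 0 := by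
      rw [h1, add_zero]
    exact (ENNReal.add_right_inj ENNReal.one_ne_top).1 this
  have hd : P (toMeasurable P s \ s) = 0 :=
    measure_mono_null (inter_subset_inter_right _ (subset_toMeasurable P sᶜ)) h0
  have he : s = toMeasurable P s \ (toMeasurable P s \ s) := by
    rw [sdiff_sdiff_cancel_left (subset_toMeasurable P s)]
  rw [he]
  exact (measurableSet_toMeasurable P s).nullMeasurableSet.diff (NullMeasurableSet.of_null hd)

/-- Metric additivity of the outer pushforward forces a.e. measurability (Carathéodory). -/
theorem aemeas_of_metric {Ω : Type*} [MeasurableSpace Ω]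
    (P : Measure Ω) [IsProbabilityMeasure P] (V : Ω → ℝ)
    (hadd : ∀ δ : ℝ, 0 < δ → ∀ B B' : Set ℝ, MeasurableSet B → MeasurableSet B' →
      (∀ b ∈ B, ∀ b' ∈ B', δ ≤ |b - b'|) →
      P (V ⁻¹' B ∪ V ⁻¹' B') = P (V ⁻¹' B) + P (V ⁻¹' B')) :
    AEMeasurable V P := by
  set G : OuterMeasure ℝ := OuterMeasure.map V P.toOuterMeasure with hG
  have hGa : ∀ s, G s = P (V ⁻¹' s) := fun s => rfl
  have hmet : G.trim.IsMetric := by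
    rintro s t ⟨r, hr0, hr⟩
    refine le_antisymm (measure_union_le s t) ?_
    obtain ⟨δ, hδ, hδr⟩ : ∃ δ : ℝ, 0 < δ ∧ ENNReal.ofReal δ ≤ r := by
      rcases eq_or_ne r ⊤ with h | h
      · exact ⟨1, one_pos, by simp [h]⟩
      · exact ⟨r.toReal, ENNReal.toReal_pos hr0 h, by rw [ENNReal.ofReal_toReal h]⟩
    have hsep : ∀ x ∈ s, ∀ y ∈ t, δ ≤ |x - y| := by
      intro x hx y hy
      have := hδr.trans (hr x hx y hy)
      rw [edist_dist, ENNReal.ofReal_le_ofReal_iff dist_nonneg, Real.dist_eq] at this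
      exact this
    obtain ⟨w, hw, hwm, hweq⟩ := G.exists_measurable_superset_eq_trim (s ∪ t)
    have hm1 : MeasurableSet (w ∩ Metric.thickening (δ/3) s) :=
      hwm.inter Metric.isOpen_thickening.measurableSet
    have hm2 : MeasurableSet (w ∩ Metric.thickening (δ/3) t) :=
      hwm.inter Metric.isOpen_thickening.measurableSet
    have key := hadd (δ/3) (by positivity) _ _ hm1 hm2 (by
      rintro b ⟨-, hb⟩ b' ⟨-, hb'⟩
      obtain ⟨x, hx, hbx⟩ := Metric.mem_thickening_iff.1 hb
      obtain ⟨y, hy, hby⟩ := Metric.mem_thickening_iff.1 hb'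
      have h1 := hsep x hx y hy
      rw [Real.dist_eq] at hbx hby
      rw [abs_lt] at hbx hby
      by_contra! h
      rw [abs_lt] at h
      rcases le_abs.1 h1 with h1 | h1 <;> linarith)
    calc G.trim s + G.trim t
        ≤ G.trim (w ∩ Metric.thickening (δ/3) s) + G.trim (w ∩ Metric.thickening (δ/3) t) := by
          gcongr
          · exact subset_inter (subset_union_left.trans hw)
              (Metric.self_subset_thickening (by positivity) _)
          · exact subset_inter (subset_union_right.trans hw)
              (Metric.self_subset_thickening (by positivity) _)
      _ = P (V ⁻¹' (w ∩ Metric.thickening (δ/3) s)) +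
            P (V ⁻¹' (w ∩ Metric.thickening (δ/3) t)) := by
          rw [OuterMeasure.trim_eq _ hm1, OuterMeasure.trim_eq _ hm2, hGa, hGa]
      _ ≤ P (V ⁻¹' w) := by
          rw [← key]
          apply measure_mono
          rintro x (hx | hx)
          · exact hx.1
          · exact hx.1
      _ = G.trim (s ∪ t) := by rw [← hweq, hGa]
  have hcar := hmet.borel_le_caratheodory
  apply NullMeasurable.aemeasurable
  intro B hB
  apply nullMeas_of_add_compl
  have hB' : MeasurableSet[borel ℝ] B := by
    rw [← BorelSpace.measurable_eq (α := ℝ)]; exact hB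
  have h := (OuterMeasure.isCaratheodory_iff _).1 (hcar B hB') univ
  rw [univ_inter, ← compl_eq_univ_sdiff, OuterMeasure.trim_eq _ hB,
    OuterMeasure.trim_eq _ hB.compl, OuterMeasure.trim_eq _ MeasurableSet.univ,
    hGa, hGa, hGa, preimage_univ, measure_univ] at h
  exact h.symm

open scoped Pointwise in
/-- Independence together with a.e. measurability of the rate gives a.e. measurability of
the interference, unless the signal vanishes almost surely. -/
theorem aemeas_interference {Ω : Type*} [MeasurableSpace Ω]
    (P : Measure Ω) [IsProbabilityMeasure P]
    (Y I : Ω → ℝ) (hYI : ProbabilityTheory.IndepFun Y I P)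
    (hI0 : ∀ ω, 0 ≤ I ω)
    (σ2 : ℝ) (hσ : 0 < σ2)
    (hZ : AEMeasurable (fun ω => Y ω / (I ω + σ2)) P)
    (hpos : P {ω | 0 < Y ω} ≠ 0) : AEMeasurable I P := by
  set V : Ω → ℝ := fun ω => Real.log (I ω + σ2) with hV
  have hK : AEMeasurable (fun ω => Real.log (Y ω / (I ω + σ2))) P :=
    Real.measurable_log.comp_aemeasurable hZ
  have hYV : ProbabilityTheory.IndepFun Y V P :=
    hYI.comp (φ := id) (ψ := fun x => Real.log (x + σ2)) measurable_id (by fun_prop)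
  have hVm : AEMeasurable V P := by
    apply aemeas_of_metric
    intro δ hδ B B' hB hB' hsep
    obtain ⟨c, hc⟩ : ∃ q : ℚ, P {ω | 0 < Y ω ∧ Real.log (Y ω) ∈ Metric.ball (q : ℝ) (δ/2)} ≠ 0 := by
      by_contra! h
      apply hpos
      refine measure_mono_null ?_ (measure_iUnion_null h)
      intro ω hω
      obtain ⟨q, hq1, hq2⟩ := exists_rat_btwn
        (show Real.log (Y ω) < Real.log (Y ω) + δ/2 by linarith)
      refine mem_iUnion.2 ⟨q, hω, ?_⟩
      rw [Metric.mem_ball, Real.dist_eq, abs_lt]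
      constructor <;> linarith
    set J := Metric.ball (c : ℝ) (δ/2) with hJ
    set A : Set ℝ := Ioi 0 ∩ Real.log ⁻¹' J with hA
    have hAm : MeasurableSet A :=
      measurableSet_Ioi.inter (Real.measurable_log Metric.isOpen_ball.measurableSet)
    have hc' : P (Y ⁻¹' A) ≠ 0 := hc
    have hE : NullMeasurableSet ((fun ω => Real.log (Y ω / (I ω + σ2))) ⁻¹' (J - B)) P :=
      hK.nullMeasurable (IsOpen.sub_right Metric.isOpen_ball).measurableSet
    have hlog : ∀ ω, Y ω ∈ A → Real.log (Y ω / (I ω + σ2)) = Real.log (Y ω) - V ω := by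
      intro ω h
      exact Real.log_div (ne_of_gt h.1) (by have := hI0 ω; positivity)
    have hsplit := measure_inter_add_sdiff₀ (μ := P) (Y ⁻¹' A ∩ V ⁻¹' (B ∪ B')) hE
    have e1 : (Y ⁻¹' A ∩ V ⁻¹' (B ∪ B')) ∩
        ((fun ω => Real.log (Y ω / (I ω + σ2))) ⁻¹' (J - B)) = Y ⁻¹' A ∩ V ⁻¹' B ∧
        (Y ⁻¹' A ∩ V ⁻¹' (B ∪ B')) \
        ((fun ω => Real.log (Y ω / (I ω + σ2))) ⁻¹' (J - B)) = Y ⁻¹' A ∩ V ⁻¹' B' := by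
      have hin : ∀ ω, Y ω ∈ A → V ω ∈ B → Real.log (Y ω / (I ω + σ2)) ∈ J - B := by
        intro ω h1 h2
        rw [hlog ω h1]
        exact Set.sub_mem_sub h1.2 h2
      have hout : ∀ ω, Y ω ∈ A → V ω ∈ B' → Real.log (Y ω / (I ω + σ2)) ∉ J - B := by
        intro ω h1 h2 h3
        rw [hlog ω h1] at h3
        obtain ⟨u, hu, b, hb, hub⟩ := Set.mem_sub.1 h3
        have hu' : Real.log (Y ω) ∈ J := h1.2
        rw [hJ, Metric.mem_ball, Real.dist_eq, abs_lt] at hu hu'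
        rcases le_abs.1 (hsep b hb _ h2) with h | h <;> linarith
      constructor
      · ext ω
        constructor
        · rintro ⟨⟨h1, h2 | h2⟩, h3⟩
          · exact ⟨h1, h2⟩
          · exact absurd h3 (hout ω h1 h2)
        · rintro ⟨h1, h2⟩
          exact ⟨⟨h1, Or.inl h2⟩, hin ω h1 h2⟩
      · ext ω
        constructor
        · rintro ⟨⟨h1, h2 | h2⟩, h3⟩
          · exact absurd (hin ω h1 h2) h3
          · exact ⟨h1, h2⟩
        · rintro ⟨h1, h2⟩
          exact ⟨⟨h1, Or.inr h2⟩, hout ω h1 h2⟩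
    rw [e1.1, e1.2, hYV.measure_inter_preimage_eq_mul _ _ hAm hB,
      hYV.measure_inter_preimage_eq_mul _ _ hAm hB',
      hYV.measure_inter_preimage_eq_mul _ _ hAm (hB.union hB'), ← mul_add] at hsplit
    exact ((ENNReal.mul_right_inj hc' (measure_ne_top P _)).1 hsplit).symm
  have hIV : I = fun ω => Real.exp (V ω) - σ2 := by
    ext ω
    have := hI0 ω
    rw [hV]
    simp only
    rw [Real.exp_log (by positivity)]
    ring
  rw [hIV]
  exact (Real.measurable_exp.comp_aemeasurable hVm).sub_const σ2

/-- The kernel is integrable on the half line. -/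
theorem kernel_integrable (y i s : ℝ) (hy : 0 ≤ y) (hi : 0 ≤ i) (hs : 0 < s) :
    IntegrableOn (fun z : ℝ => (1 / z) * (1 - Real.exp (-z * y)) * Real.exp (-z * i) *
      Real.exp (-z * s)) (Ioi 0) := by
  have hb : IntegrableOn (fun z : ℝ => y * Real.exp (-s * z)) (Ioi 0) :=
    (exp_neg_integrableOn_Ioi 0 hs).const_mul y
  refine Integrable.mono' hb (Measurable.aestronglyMeasurable (by fun_prop)) ?_
  filter_upwards [ae_restrict_mem measurableSet_Ioi] with z hz
  have hz : 0 < z := hz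
  have h1 : Real.exp (-z * y) ≤ 1 := Real.exp_le_one_iff.2 (by nlinarith)
  have h2 : Real.exp (-z * i) ≤ 1 := Real.exp_le_one_iff.2 (by nlinarith)
  have h3 : (1 / z) * (1 - Real.exp (-z * y)) ≤ y := by
    rw [one_div, inv_mul_le_iff₀ hz]
    have := Real.add_one_le_exp (-z * y)
    linarith
  have h4 : 0 ≤ (1 / z) * (1 - Real.exp (-z * y)) :=
    mul_nonneg (by positivity) (by linarith)
  rw [Real.norm_of_nonneg (by positivity)]
  rw [show -s * z = -z * s by ring]
  gcongr
  calc _ ≤ y * 1 := by gcongr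
    _ = y := mul_one y

/-- Frullani's integral in the form needed here. -/
theorem kernel_integral (y i s : ℝ) (hy : 0 ≤ y) (hi : 0 ≤ i) (hs : 0 < s) :
    ∫ z in Ioi (0 : ℝ), (1 / z) * (1 - Real.exp (-z * y)) * Real.exp (-z * i) *
      Real.exp (-z * s) = Real.log (1 + y / (i + s)) := by
  have he : (fun z : ℝ => (1 / z) * (1 - Real.exp (-z * y)) * Real.exp (-z * i) *
      Real.exp (-z * s)) =
      fun z => z⁻¹ • ((fun x => Real.exp (-x)) ((i + s) * z) -
        (fun x => Real.exp (-x)) ((y + i + s) * z)) := by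
    ext z
    simp only [smul_eq_mul]
    rw [show -((i + s) * z) = -z * i + -z * s by ring,
      show -((y + i + s) * z) = -z * y + -z * i + -z * s by ring]
    simp only [Real.exp_add]
    ring
  have hI := kernel_integrable y i s hy hi hs
  rw [he] at hI ⊢
  have hc : Continuous (fun x : ℝ => Real.exp (-x)) := by fun_prop
  rw [Frullani.integral_Ioi_eq (L := 1) (R := 0) (hc.locallyIntegrable.locallyIntegrableOn _)
    (by positivity) (by positivity) ?_ ?_ hI]
  · have : i + s ≠ 0 := by positivity
    rw [sub_zero, smul_eq_mul, mul_one]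
    congr 1
    field_simp
    ring
  · have := hc.tendsto 0
    simp only [neg_zero, Real.exp_zero] at this
    exact this.mono_left nhdsWithin_le_nhds
  · exact Real.tendsto_exp_neg_atTop_nhds_zero

/-- The factorization when the two variables are a.e. measurable. -/
theorem avg_rate_of_aemeasurable {Ω : Type*} [MeasurableSpace Ω]
    (P : Measure Ω) [IsProbabilityMeasure P]
    (Y I : Ω → ℝ) (hYI : ProbabilityTheory.IndepFun Y I P)
    (hY0 : ∀ ω, 0 ≤ Y ω) (hI0 : ∀ ω, 0 ≤ I ω)
    (σ2 : ℝ) (hσ : 0 < σ2)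
    (hint : Integrable (fun ω => Real.log (1 + Y ω / (I ω + σ2))) P)
    (hY : AEMeasurable Y P) (hI : AEMeasurable I P) :
    ∫ ω, Real.log (1 + Y ω / (I ω + σ2)) ∂P =
      ∫ z in Set.Ioi (0 : ℝ),
        (1 / z) * (1 - ∫ ω, Real.exp (-z * Y ω) ∂P) *
          (∫ ω, Real.exp (-z * I ω) ∂P) * Real.exp (-z * σ2) := by
  set f : Ω → ℝ → ℝ := fun ω z => (1 / z) * (1 - Real.exp (-z * Y ω)) * Real.exp (-z * I ω) *
      Real.exp (-z * σ2) with hf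
  have hprod : Integrable (Function.uncurry f) (P.prod (volume.restrict (Ioi 0))) := by
    have hYf : AEMeasurable (fun p : Ω × ℝ => Y p.1) (P.prod (volume.restrict (Ioi 0))) :=
      hY.comp_quasiMeasurePreserving Measure.quasiMeasurePreserving_fst
    have hIf : AEMeasurable (fun p : Ω × ℝ => I p.1) (P.prod (volume.restrict (Ioi 0))) :=
      hI.comp_quasiMeasurePreserving Measure.quasiMeasurePreserving_fst
    rw [integrable_prod_iff]
    · refine ⟨ae_of_all _ fun ω => kernel_integrable _ _ _ (hY0 ω) (hI0 ω) hσ, ?_⟩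
      refine hint.congr (ae_of_all _ fun ω => ?_)
      simp only [Function.uncurry]
      rw [← kernel_integral _ _ _ (hY0 ω) (hI0 ω) hσ]
      refine setIntegral_congr_fun measurableSet_Ioi fun z hz => ?_
      have hz : 0 < z := hz
      have h1 : Real.exp (-z * Y ω) ≤ 1 :=
        Real.exp_le_one_iff.2 (by have := mul_nonneg hz.le (hY0 ω); linarith)
      have h4 : 0 ≤ (1 / z) * (1 - Real.exp (-z * Y ω)) :=
        mul_nonneg (by positivity) (by linarith)
      exact (Real.norm_of_nonneg (by positivity)).symm
    · apply AEMeasurable.aestronglyMeasurable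
      simp only [hf, Function.uncurry_def]
      fun_prop
  calc ∫ ω, Real.log (1 + Y ω / (I ω + σ2)) ∂P
      = ∫ ω, (∫ z in Ioi (0 : ℝ), f ω z) ∂P := by
        congr 1
        ext ω
        exact (kernel_integral _ _ _ (hY0 ω) (hI0 ω) hσ).symm
    _ = ∫ z in Ioi (0 : ℝ), ∫ ω, f ω z ∂P := integral_integral_swap hprod
    _ = _ := by
        refine setIntegral_congr_fun measurableSet_Ioi fun z hz => ?_
        have hz : 0 < z := hz
        have hind : ProbabilityTheory.IndepFun (fun ω => 1 - Real.exp (-z * Y ω))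
            (fun ω => Real.exp (-z * I ω)) P :=
          hYI.comp (φ := fun y => 1 - Real.exp (-z * y)) (ψ := fun y => Real.exp (-z * y))
            (by fun_prop) (by fun_prop)
        have hYe : AEMeasurable (fun ω => Real.exp (-z * Y ω)) P := by fun_prop
        have hYi : Integrable (fun ω => Real.exp (-z * Y ω)) P := by
          refine Integrable.of_bound hYe.aestronglyMeasurable 1 (ae_of_all _ fun ω => ?_)
          rw [Real.norm_of_nonneg (by positivity)]
          exact Real.exp_le_one_iff.2 (by have := mul_nonneg hz.le (hY0 ω); linarith)
        have h1 := hind.integral_fun_mul_eq_mul_integral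
          (AEMeasurable.aestronglyMeasurable (by fun_prop))
          (AEMeasurable.aestronglyMeasurable (by fun_prop))
        rw [integral_sub (integrable_const _) hYi] at h1
        simp only [integral_const, probReal_univ, one_smul] at h1
        simp only [hf]
        rw [integral_mul_const]
        simp only [mul_assoc]
        rw [integral_const_mul, h1]
        ring

/-- Average-rate factorization via Laplace transforms: if `Y` and `I` are independent
nonnegative random variables and `σ² > 0`, then
`E[ln(1 + Y/(I + σ²))] = ∫_0^∞ (1/z)(1 − E[e^{−zY}]) E[e^{−zI}] e^{−zσ²} dz`. -/
theorem avg_rate_laplace_factorization {Ω : Type*} [MeasurableSpace Ω]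
    (P : Measure Ω) [IsProbabilityMeasure P]
    (Y I : Ω → ℝ) (hYI : ProbabilityTheory.IndepFun Y I P)
    (hY0 : ∀ ω, 0 ≤ Y ω) (hI0 : ∀ ω, 0 ≤ I ω)
    (σ2 : ℝ) (hσ : 0 < σ2)
    (hint : Integrable (fun ω => Real.log (1 + Y ω / (I ω + σ2))) P) :
    ∫ ω, Real.log (1 + Y ω / (I ω + σ2)) ∂P =
      ∫ z in Set.Ioi (0 : ℝ),
        (1 / z) * (1 - ∫ ω, Real.exp (-z * Y ω) ∂P) *
          (∫ ω, Real.exp (-z * I ω) ∂P) * Real.exp (-z * σ2) := by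
  by_cases hpos : P {ω | 0 < Y ω} = 0
  · have hY : Y =ᵐ[P] fun _ => 0 := by
      rw [Filter.EventuallyEq, ae_iff]
      refine measure_mono_null (fun ω hω => ?_) hpos
      exact lt_of_le_of_ne (hY0 ω) (Ne.symm hω)
    have hL : ∫ ω, Real.log (1 + Y ω / (I ω + σ2)) ∂P = 0 := by
      rw [integral_congr_ae (g := fun _ => (0 : ℝ))]
      · simp
      · filter_upwards [hY] with ω hω
        simp [hω]
    have hE : ∀ z : ℝ, ∫ ω, Real.exp (-z * Y ω) ∂P = 1 := by
      intro z
      rw [integral_congr_ae (g := fun _ => (1 : ℝ))]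
      · simp
      · filter_upwards [hY] with ω hω
        simp [hω]
    rw [hL]
    simp only [hE, sub_self, mul_zero, zero_mul, integral_zero]
  · have hZ : AEMeasurable (fun ω => Y ω / (I ω + σ2)) P := by
      have h := (Real.measurable_exp.comp_aemeasurable hint.aemeasurable).sub_const 1
      refine h.congr (ae_of_all _ fun ω => ?_)
      have h1 := hY0 ω
      have h2 := hI0 ω
      simp only [Function.comp]
      rw [Real.exp_log (by positivity)]
      ring
    have hI := aemeas_interference P Y I hYI hI0 σ2 hσ hZ hpos
    have hY : AEMeasurable Y P := by
      refine (hZ.mul (hI.add_const σ2)).congr (ae_of_all _ fun ω => ?_)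
      have h2 := hI0 ω
      have h3 : I ω + σ2 ≠ 0 := by positivity
      simp only [Pi.mul_apply]
      field_simp
    exact avg_rate_of_aemeasurable P Y I hYI hY0 hI0 σ2 hσ hint hY hI
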